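/- Let F : [1,∞) → ℝ be continuous with ∫_1^∞ |F(s)| ds < ∞, and let g be a twice continuously differentiable function on [1,∞) satisfying g''(ρ) + g(ρ) + g(ρ)/(4ρ²) = F(ρ) and such that g(ρ)² + g'(ρ)² → 0 as ρ → ∞. Then for all ρ ≥ 1, (g'(ρ)² + g(ρ)²)^{1/2} ≤ e^{1/(8ρ)} ∫_ρ^∞ |F(s)| ds ≤ 2 ∫_ρ^∞ |F(s)| ds. -/

import Mathlib

open Real MeasureTheory

/-- The regularized energy `√(g² + g'² + ε)`, weighted by the integrating factor
`e^{-1/(8ρ)}`, decreases over `[a, b]` by at most `∫_a^b |F|`. -/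
theorem weighted_sqrt_energy_le {F g g' g'' : ℝ → ℝ} {a b ε : ℝ} (ha : 0 < a) (hab : a ≤ b)
    (hε : 0 < ε) (hFi : IntegrableOn F (Set.Icc a b))
    (hg : ∀ x ∈ Set.Icc a b, HasDerivAt g (g' x) x)
    (hg' : ∀ x ∈ Set.Icc a b, HasDerivAt g' (g'' x) x)
    (heq : ∀ x ∈ Set.Icc a b, g'' x + g x + g x / (4 * x ^ 2) = F x) :
    exp (-(8 * a)⁻¹) * √(g a ^ 2 + g' a ^ 2 + ε) ≤
      exp (-(8 * b)⁻¹) * √(g b ^ 2 + g' b ^ 2 + ε) + ∫ s in a..b, |F s| := by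
  have hder : ∀ x ∈ Set.Icc a b,
      HasDerivAt (fun x => exp (-(8 * x)⁻¹) * √(g x ^ 2 + g' x ^ 2 + ε))
        (exp (-(8 * x)⁻¹) * (8 / (8 * x) ^ 2) * √(g x ^ 2 + g' x ^ 2 + ε) +
          exp (-(8 * x)⁻¹) *
            ((2 * g x * g' x + 2 * g' x * g'' x) / (2 * √(g x ^ 2 + g' x ^ 2 + ε)))) x := by
    intro x hx
    have hx0 : 0 < x := ha.trans_le hx.1
    have hμ : HasDerivAt (fun x : ℝ => exp (-(8 * x)⁻¹))
        (exp (-(8 * x)⁻¹) * (8 / (8 * x) ^ 2)) x := by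
      have h := ((((hasDerivAt_id x).const_mul 8).fun_inv (by simpa using hx0.ne')).fun_neg).exp
      simpa [neg_div] using h
    have hE : HasDerivAt (fun x => g x ^ 2 + g' x ^ 2 + ε)
        (2 * g x * g' x + 2 * g' x * g'' x) x := by
      have h := (((hg x hx).fun_pow 2).fun_add ((hg' x hx).fun_pow 2)).add_const ε
      simpa using h
    exact hμ.mul (hE.sqrt (by positivity))
  have hkey := intervalIntegral.integral_le_sub_of_hasDeriv_right_of_le hab
    (fun x hx => (hder x hx).continuousAt.continuousWithinAt)
    (fun x hx => (hder x (Set.Ioo_subset_Icc_self hx)).hasDerivWithinAt)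
    (φ := fun x => -|F x|) hFi.norm.neg ?_
  · rw [intervalIntegral.integral_neg] at hkey
    linarith
  · intro x hx
    have hx' := Set.Ioo_subset_Icc_self hx
    have hx0 : 0 < x := ha.trans_le hx'.1
    have hE : 0 < g x ^ 2 + g' x ^ 2 + ε := by positivity
    set h := √(g x ^ 2 + g' x ^ 2 + ε) with hh
    have hpos : 0 < h := Real.sqrt_pos.2 hE
    have hsq : h ^ 2 = g x ^ 2 + g' x ^ 2 + ε := Real.sq_sqrt hE.le
    have hμ1 : exp (-(8 * x)⁻¹) ≤ 1 := Real.exp_le_one_iff.2 (by simpa using hx0.le)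
    have hμ0 := Real.exp_pos (-(8 * x)⁻¹)
    have hg'h : |g' x| ≤ h := Real.abs_le_sqrt (by nlinarith [sq_nonneg (g x)])
    have hF : -(h * |F x|) ≤ g' x * F x := by
      have h1 := neg_abs_le (g' x * F x)
      rw [abs_mul] at h1
      nlinarith [mul_le_mul_of_nonneg_right hg'h (abs_nonneg (F x))]
    have hode : g'' x = F x - g x - g x / (4 * x ^ 2) := by linarith [heq x hx']
    have hlow : -|F x| ≤ 8 / (8 * x) ^ 2 * h + (2 * g x * g' x + 2 * g' x * g'' x) / (2 * h) := by
      have hid : 8 / (8 * x) ^ 2 * h + (2 * g x * g' x + 2 * g' x * g'' x) / (2 * h) =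
          (g' x * F x + (h ^ 2 - 2 * (g x * g' x)) / (8 * x ^ 2)) / h := by
        rw [hode]
        field_simp
        ring
      rw [hid, le_div_iff₀ hpos]
      have : 0 ≤ (h ^ 2 - 2 * (g x * g' x)) / (8 * x ^ 2) :=
        div_nonneg (by nlinarith [sq_nonneg (g x - g' x)]) (by positivity)
      linarith
    calc -|F x| ≤ exp (-(8 * x)⁻¹) * -|F x| := by nlinarith [abs_nonneg (F x)]
      _ ≤ _ := mul_le_mul_of_nonneg_left hlow hμ0.le
      _ = _ := by ring

/-- Decay estimate for the linearized ODE `L'(0)g = g'' + g + g/(4ρ²) = F`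
with vanishing data at infinity:
`(g'² + g²)^{1/2} ≤ e^{1/(8ρ)} ∫_ρ^∞ |F| ≤ 2 ∫_ρ^∞ |F|` for `ρ ≥ 1`. -/
theorem linearized_ode_energy_bound (F g g' g'' : ℝ → ℝ)
    (hFc : ContinuousOn F (Set.Ici 1))
    (hFi : IntegrableOn F (Set.Ici 1))
    (hg : ∀ ρ : ℝ, 1 ≤ ρ → HasDerivAt g (g' ρ) ρ)
    (hg' : ∀ ρ : ℝ, 1 ≤ ρ → HasDerivAt g' (g'' ρ) ρ)
    (hg'' : ContinuousOn g'' (Set.Ici 1))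
    (heq : ∀ ρ : ℝ, 1 ≤ ρ → g'' ρ + g ρ + g ρ / (4 * ρ ^ 2) = F ρ)
    (hlim : Filter.Tendsto (fun ρ => (g ρ) ^ 2 + (g' ρ) ^ 2) Filter.atTop (nhds 0)) :
    ∀ ρ : ℝ, 1 ≤ ρ →
      Real.sqrt ((g' ρ) ^ 2 + (g ρ) ^ 2)
          ≤ Real.exp (1 / (8 * ρ)) * ∫ s in Set.Ici ρ, |F s| ∧
      Real.exp (1 / (8 * ρ)) * ∫ s in Set.Ici ρ, |F s|
          ≤ 2 * ∫ s in Set.Ici ρ, |F s| := by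
  intro ρ hρ
  have hρ0 : 0 < ρ := one_pos.trans_le hρ
  have hI0 : 0 ≤ ∫ s in Set.Ici ρ, |F s| := integral_nonneg fun s => abs_nonneg (F s)
  have hFρ : IntegrableOn F (Set.Ici ρ) := hFi.mono_set (Set.Ici_subset_Ici.2 hρ)
  refine ⟨?_, mul_le_mul_of_nonneg_right ?_ hI0⟩
  · have hmain : exp (-(8 * ρ)⁻¹) * √(g' ρ ^ 2 + g ρ ^ 2) ≤ ∫ s in Set.Ici ρ, |F s| := by
      refine le_of_forall_pos_le_add fun δ hδ => ?_
      obtain ⟨R, hR, hρR⟩ := ((hlim.eventually_lt_const (show 0 < δ ^ 2 / 2 by positivity)).and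
        (Filter.eventually_ge_atTop ρ)).exists
      have hle : ∀ x ∈ Set.Icc ρ R, 1 ≤ x := fun x hx => hρ.trans hx.1
      have hbound := weighted_sqrt_energy_le hρ0 hρR (show 0 < δ ^ 2 / 2 by positivity)
        (hFρ.mono_set Set.Icc_subset_Ici_self) (fun x hx => hg x (hle x hx))
        (fun x hx => hg' x (hle x hx)) (fun x hx => heq x (hle x hx))
      have hint : ∫ s in ρ..R, |F s| ≤ ∫ s in Set.Ici ρ, |F s| := by
        rw [intervalIntegral.integral_of_le hρR]
        exact setIntegral_mono_set hFρ.norm (ae_of_all _ fun s => abs_nonneg (F s))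
          (Set.Ioc_subset_Icc_self.trans Set.Icc_subset_Ici_self).eventuallyLE
      have hend : exp (-(8 * R)⁻¹) * √(g R ^ 2 + g' R ^ 2 + δ ^ 2 / 2) ≤ δ := by
        have h1 : exp (-(8 * R)⁻¹) ≤ 1 :=
          Real.exp_le_one_iff.2 (by simpa using (hρ0.trans_le hρR).le)
        have h2 : √(g R ^ 2 + g' R ^ 2 + δ ^ 2 / 2) ≤ δ :=
          Real.sqrt_le_iff.2 ⟨hδ.le, by linarith⟩
        exact (mul_le_of_le_one_left (Real.sqrt_nonneg _) h1).trans h2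
      have hstart : exp (-(8 * ρ)⁻¹) * √(g' ρ ^ 2 + g ρ ^ 2) ≤
          exp (-(8 * ρ)⁻¹) * √(g ρ ^ 2 + g' ρ ^ 2 + δ ^ 2 / 2) :=
        mul_le_mul_of_nonneg_left (Real.sqrt_le_sqrt (by nlinarith)) (Real.exp_pos _).le
      linarith
    rw [one_div]
    rwa [Real.exp_neg, inv_mul_le_iff₀ (Real.exp_pos _)] at hmain
  · have h8 : 1 / (8 * ρ) ≤ 1 / 2 := one_div_le_one_div_of_le two_pos (by linarith)
    have h1 := Real.add_one_le_exp (-(1 / (8 * ρ)))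
    rw [Real.exp_neg] at h1
    calc exp (1 / (8 * ρ)) = ((exp (1 / (8 * ρ)))⁻¹)⁻¹ := (inv_inv _).symm
      _ ≤ (1 / 2)⁻¹ := inv_anti₀ (by norm_num) (by linarith)
      _ = 2 := by norm_num
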